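/- arXiv:1205.5077 — 3 statements merged into one kernel-verified Lean document; each statement's English description precedes it below -/
import Mathlib

section
/- The ideal class group of the ring of integers of the imaginary quadratic field ℚ(√−47) is cyclic of order 5, i.e., it is isomorphic to ℤ/5ℤ. -/
open NumberField Module
open scoped nonZeroDivisors Real QuadraticAlgebra

/-- A subgroup of the class group containing the classes of all nonzero prime ideals whose norm is
at most the Minkowski bound is the whole class group. -/
theorem NumberField.classGroup_subgroup_eq_top {K : Type*} [Field K] [NumberField K]
    (H : Subgroup (ClassGroup (𝓞 K)))
    (h : ∀ I : (Ideal (𝓞 K))⁰, (I : Ideal (𝓞 K)).IsPrime →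
      (Ideal.absNorm (I : Ideal (𝓞 K)) : ℝ) ≤ (4 / π) ^ InfinitePlace.nrComplexPlaces K *
        ((finrank ℚ K).factorial / (finrank ℚ K) ^ (finrank ℚ K) * √|(discr K : ℤ)|) →
      ClassGroup.mk0 I ∈ H) : H = ⊤ := by
  refine (Subgroup.eq_top_iff' H).mpr fun C ↦ ?_
  obtain ⟨⟨I, hI0⟩, rfl, hI⟩ := exists_ideal_in_class_of_norm_le C
  induction I using UniqueFactorizationMonoid.induction_on_prime with
  | h₁ => exact absurd rfl (mem_nonZeroDivisors_iff_ne_zero.mp hI0)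
  | h₂ J hJ =>
    have : ClassGroup.mk0 (⟨J, hI0⟩ : (Ideal (𝓞 K))⁰) = 1 := by
      rw [ClassGroup.mk0_eq_one_iff, Ideal.isUnit_iff.mp hJ]
      exact top_isPrincipal
    exact this ▸ H.one_mem
  | h₃ J P hJ hP ih =>
    have hJ0 := mem_nonZeroDivisors_iff_ne_zero.mpr hJ
    have hP0 := mem_nonZeroDivisors_iff_ne_zero.mpr hP.ne_zero
    have hJ1 := Ideal.absNorm_pos_of_nonZeroDivisors (⟨J, hJ0⟩ : (Ideal (𝓞 K))⁰)
    have hP1 := Ideal.absNorm_pos_of_nonZeroDivisors (⟨P, hP0⟩ : (Ideal (𝓞 K))⁰)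
    have hmul : ClassGroup.mk0 (⟨P * J, hI0⟩ : (Ideal (𝓞 K))⁰) =
        ClassGroup.mk0 ⟨P, hP0⟩ * ClassGroup.mk0 ⟨J, hJ0⟩ := by
      rw [← map_mul]; rfl
    rw [hmul]
    simp only [map_mul] at hI
    refine H.mul_mem (h _ (Ideal.isPrime_of_prime hP) ?_) (ih hJ0 ?_)
    · exact le_trans (mod_cast Nat.le_mul_of_pos_right _ hJ1) hI
    · exact le_trans (mod_cast Nat.le_mul_of_pos_left _ hP1) hI

namespace QuadraticAlgebra

theorem algebraTrace_eq_trace {R : Type*} [CommRing R] {a b : R} (z : QuadraticAlgebra R a b) :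
    Algebra.trace R (QuadraticAlgebra R a b) z = trace z := by
  rw [Algebra.trace_eq_matrix_trace (basis a b), Matrix.trace_fin_two, trace_def]
  simp [Algebra.leftMulMatrix_eq_repr_mul, basis]
  ring

theorem discr_basis {R : Type*} [CommRing R] (a b : R) :
    Algebra.discr R (basis a b) = b ^ 2 + 4 * a := by
  rw [Algebra.discr_def, Matrix.det_fin_two]
  simp [Algebra.traceMatrix_apply, Algebra.traceForm_apply, algebraTrace_eq_trace, trace_def, basis]
  ring

/-- If the norm form is anisotropic, a quadratic algebra embeds into every faithful
algebra that it maps to. -/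
theorem algHom_injective {R A : Type*} [CommRing R] {a b : R} [Ring A] [Algebra R A]
    [FaithfulSMul R A] (h : ∀ z : QuadraticAlgebra R a b, norm z = 0 → z = 0)
    (f : QuadraticAlgebra R a b →ₐ[R] A) : Function.Injective f := by
  refine (injective_iff_map_eq_zero f).mpr fun z hz ↦ h z ?_
  apply FaithfulSMul.algebraMap_injective R A
  rw [map_zero, ← f.commutes, algebraMap_norm_eq_mul_star, map_mul, hz, zero_mul]

theorem eq_zero_of_norm_eq_zero {R : Type*} [CommRing R] [LinearOrder R] [IsStrictOrderedRing R]
    {a b : R} (hab : b ^ 2 + 4 * a < 0) (z : QuadraticAlgebra R a b) (h : norm z = 0) : z = 0 := by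
  rw [norm_def] at h
  have key : (2 * z.re + b * z.im) ^ 2 + -(b ^ 2 + 4 * a) * z.im ^ 2 = 0 := by
    linear_combination 4 * h
  have him : z.im = 0 := by
    by_contra him
    have := mul_pos (neg_pos.mpr hab) (sq_pos_of_ne_zero him)
    nlinarith [sq_nonneg (2 * z.re + b * z.im)]
  have hre : z.re = 0 := by simpa [him] using h
  ext <;> simp [hre, him]

end QuadraticAlgebra

theorem Rat.isInt_of_trace_norm_isInt {p q : ℚ} {t n : ℤ} (ht : 2 * p + q = t)
    (hn : p * p + p * q + 12 * q * q = n) : ∃ k l : ℤ, p = k ∧ q = l := by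
  have hsq : (47 * q) ^ 2 = (47 * (4 * n - t ^ 2) : ℤ) := by
    push_cast
    rw [← ht, ← hn]
    ring
  obtain ⟨s, hs⟩ : ∃ s : ℤ, (s : ℚ) = 47 * q :=
    IsIntegrallyClosed.isIntegral_iff.mp <| IsIntegral.of_pow (R := ℤ) two_pos <|
      hsq ▸ isIntegral_algebraMap (R := ℤ) (A := ℚ)
  have hs2 : s ^ 2 = 47 * (4 * n - t ^ 2) := by
    rw [← hs] at hsq
    exact_mod_cast hsq
  have h47 : Prime (47 : ℤ) := Int.prime_iff_natAbs_prime.mpr (by norm_num)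
  obtain ⟨l, rfl⟩ := h47.dvd_of_dvd_pow ⟨_, hs2⟩
  have hql : q = l := by
    push_cast at hs
    linarith
  have hpar : 4 * n = t ^ 2 + 47 * l ^ 2 := by linarith
  have heven : Even (t - l) := by
    have : Even (t ^ 2 + 47 * l ^ 2) := hpar ▸ ⟨2 * n, by ring⟩
    have h47 : ¬Even (47 : ℤ) := by decide
    simp only [Int.even_add, Int.even_pow, Int.even_mul, h47, Int.even_sub] at this ⊢
    tauto
  obtain ⟨k, hk⟩ := heven
  refine ⟨k, l, ?_, hql⟩
  have : (t : ℚ) - l = k + k := by exact_mod_cast hk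
  linarith

section IdealRelations

variable {R : Type*} [CommRing R] {θ : R}

theorem span_two_mul_span_two (h : θ ^ 2 = θ - 12) :
    Ideal.span {2, θ} * Ideal.span {2, θ - 1} = Ideal.span {(2 : R)} := by
  rw [Ideal.span_pair_mul_span_pair]
  apply le_antisymm
  · simp only [Ideal.span_le, Set.insert_subset_iff, Set.singleton_subset_iff, SetLike.mem_coe,
      Ideal.mem_span_singleton']
    exact ⟨⟨2, by ring⟩, ⟨θ - 1, by ring⟩, ⟨θ, by ring⟩, ⟨-6, by linear_combination -h⟩⟩
  · simp only [Ideal.span_le, Set.singleton_subset_iff, SetLike.mem_coe, Ideal.mem_span_insert,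
      Ideal.mem_span_singleton']
    exact ⟨0, _, ⟨-1, _, ⟨1, _, ⟨0, rfl⟩, rfl⟩, rfl⟩, by ring⟩

theorem span_three_mul_span_three (h : θ ^ 2 = θ - 12) :
    Ideal.span {3, θ} * Ideal.span {3, θ - 1} = Ideal.span {(3 : R)} := by
  rw [Ideal.span_pair_mul_span_pair]
  apply le_antisymm
  · simp only [Ideal.span_le, Set.insert_subset_iff, Set.singleton_subset_iff, SetLike.mem_coe,
      Ideal.mem_span_singleton']
    exact ⟨⟨3, by ring⟩, ⟨θ - 1, by ring⟩, ⟨θ, by ring⟩, ⟨-4, by linear_combination -h⟩⟩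
  · simp only [Ideal.span_le, Set.singleton_subset_iff, SetLike.mem_coe, Ideal.mem_span_insert,
      Ideal.mem_span_singleton']
    exact ⟨0, _, ⟨-1, _, ⟨1, _, ⟨0, rfl⟩, rfl⟩, rfl⟩, by ring⟩

theorem span_two_sq (h : θ ^ 2 = θ - 12) :
    Ideal.span {2, θ} ^ 2 = Ideal.span {(4 : R), θ} := by
  rw [pow_two, Ideal.span_pair_mul_span_pair]
  apply le_antisymm
  · simp only [Ideal.span_le, Set.insert_subset_iff, Set.singleton_subset_iff, SetLike.mem_coe,
      Ideal.mem_span_pair]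
    exact ⟨⟨1, 0, by ring⟩, ⟨0, 2, by ring⟩, ⟨0, 2, by ring⟩, ⟨0, θ, by ring⟩⟩
  · simp only [Ideal.span_le, Set.insert_subset_iff, Set.singleton_subset_iff, SetLike.mem_coe,
      Ideal.mem_span_insert, Ideal.mem_span_singleton']
    exact ⟨⟨1, _, ⟨0, _, ⟨0, _, ⟨0, rfl⟩, rfl⟩, rfl⟩, by ring⟩,
      ⟨3, _, ⟨0, _, ⟨0, _, ⟨1, rfl⟩, rfl⟩, rfl⟩, by linear_combination -h⟩⟩

theorem span_four_sq (h : θ ^ 2 = θ - 12) :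
    Ideal.span {4, θ} ^ 2 = Ideal.span {(16 : R), θ + 4} := by
  rw [pow_two, Ideal.span_pair_mul_span_pair]
  apply le_antisymm
  · simp only [Ideal.span_le, Set.insert_subset_iff, Set.singleton_subset_iff, SetLike.mem_coe,
      Ideal.mem_span_pair]
    exact ⟨⟨1, 0, by ring⟩, ⟨-1, 4, by ring⟩, ⟨-1, 4, by ring⟩,
      ⟨-1, 1, by linear_combination -h⟩⟩
  · simp only [Ideal.span_le, Set.insert_subset_iff, Set.singleton_subset_iff, SetLike.mem_coe,
      Ideal.mem_span_insert, Ideal.mem_span_singleton']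
    exact ⟨⟨1, _, ⟨0, _, ⟨0, _, ⟨0, rfl⟩, rfl⟩, rfl⟩, by ring⟩,
      ⟨1, _, ⟨0, _, ⟨0, _, ⟨1, rfl⟩, rfl⟩, rfl⟩, by linear_combination -h⟩⟩

theorem span_sixteen_mul_span_two (h : θ ^ 2 = θ - 12) :
    Ideal.span {16, θ + 4} * Ideal.span {2, θ} = Ideal.span {θ + 4} := by
  rw [Ideal.span_pair_mul_span_pair]
  apply le_antisymm
  · simp only [Ideal.span_le, Set.insert_subset_iff, Set.singleton_subset_iff, SetLike.mem_coe,
      Ideal.mem_span_singleton']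
    exact ⟨⟨5 - θ, by linear_combination -h⟩,
      ⟨16 - 2 * (5 - θ), by linear_combination 2 * h⟩, ⟨2, by ring⟩, ⟨θ, by ring⟩⟩
  · simp only [Ideal.span_le, Set.singleton_subset_iff, SetLike.mem_coe, Ideal.mem_span_insert,
      Ideal.mem_span_singleton']
    exact ⟨1, _, ⟨0, _, ⟨-2, _, ⟨1, rfl⟩, rfl⟩, rfl⟩, by linear_combination -h⟩

theorem span_two_pow_five (h : θ ^ 2 = θ - 12) :
    Ideal.span {2, θ} ^ 5 = Ideal.span {θ + 4} := by
  rw [← span_sixteen_mul_span_two h, ← span_four_sq h, ← span_two_sq h]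
  ring

theorem span_two_sq_mul_span_three (h : θ ^ 2 = θ - 12) :
    Ideal.span {2, θ} ^ 2 * Ideal.span {3, θ} = Ideal.span {θ} := by
  rw [span_two_sq h, Ideal.span_pair_mul_span_pair]
  apply le_antisymm
  · simp only [Ideal.span_le, Set.insert_subset_iff, Set.singleton_subset_iff, SetLike.mem_coe,
      Ideal.mem_span_singleton']
    exact ⟨⟨1 - θ, by linear_combination -h⟩, ⟨4, by ring⟩, ⟨3, by ring⟩, ⟨θ, by ring⟩⟩
  · simp only [Ideal.span_le, Set.singleton_subset_iff, SetLike.mem_coe, Ideal.mem_span_insert,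
      Ideal.mem_span_singleton']
    exact ⟨0, _, ⟨1, _, ⟨-1, _, ⟨0, rfl⟩, rfl⟩, rfl⟩, by ring⟩

/-- If `R` is generated by `θ` as `ℤ + ℤ θ`, a proper ideal containing a prime `p` and `θ - r` is
generated by these two elements. -/
theorem Ideal.eq_span_pair_of_mem (hR : ∀ x : R, ∃ k l : ℤ, x = k + l * θ) {I : Ideal R}
    (hI : I ≠ ⊤) {p : ℕ} (hp : p.Prime) (r : ℤ) (hpI : (p : R) ∈ I) (hθ : θ - r ∈ I) :
    I = Ideal.span {(p : R), θ - r} := by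
  refine le_antisymm (fun x hx ↦ ?_) ?_
  · obtain ⟨k, l, rfl⟩ := hR x
    have hmem : ((k + l * r : ℤ) : R) ∈ I := by
      convert I.sub_mem hx (I.mul_mem_left (l : R) hθ) using 1
      push_cast
      ring
    have hdvd : (p : ℤ) ∣ k + l * r := by
      by_contra hndvd
      obtain ⟨u, v, huv⟩ := ((Nat.prime_iff_prime_int.mp hp).coprime_iff_not_dvd).mpr hndvd
      refine hI ((Ideal.eq_top_iff_one I).mpr ?_)
      have := I.add_mem (I.mul_mem_left (u : R) hpI) (I.mul_mem_left (v : R) hmem)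
      convert this using 1
      exact_mod_cast congrArg (Int.cast (R := R)) huv.symm
    obtain ⟨m, hm⟩ := hdvd
    refine Ideal.mem_span_pair.mpr ⟨m, l, ?_⟩
    have : (k : R) + l * r = p * m := by exact_mod_cast congrArg (Int.cast (R := R)) hm
    linear_combination -this
  · rw [Ideal.span_le, Set.insert_subset_iff, Set.singleton_subset_iff]
    exact ⟨hpI, hθ⟩

end IdealRelations

namespace QuadraticAlgebra

/-- The ring of integers of `ℚ(√-47)` is `ℤ[(1 + √-47) / 2]`. -/
theorem nonempty_algEquiv_ringOfIntegers {K : Type*} [Field K] [NumberField K]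
    (a : K) (ha : a ^ 2 = -47) (hK : finrank ℚ K = 2) :
    Nonempty (QuadraticAlgebra ℤ (-12) 1 ≃ₐ[ℤ] 𝓞 K) := by
  have hθ : (1 + a) / 2 * ((1 + a) / 2) = (1 + a) / 2 - 12 := by linear_combination ha / 4
  have hθint : IsIntegral ℤ ((1 + a) / 2) := by
    refine ⟨.X ^ 2 - .X + 12, by monicity!, ?_⟩
    have : Polynomial.eval₂ (algebraMap ℤ K) ((1 + a) / 2) 12 = 12 :=
      Polynomial.eval₂_ofNat _ _ _
    simp only [Polynomial.eval₂_add, Polynomial.eval₂_sub, Polynomial.eval₂_X_pow,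
      Polynomial.eval₂_X, this]
    linear_combination hθ
  obtain ⟨θ, hθK⟩ : ∃ θ : 𝓞 K, algebraMap (𝓞 K) K θ = (1 + a) / 2 := ⟨⟨_, hθint⟩, rfl⟩
  let f : QuadraticAlgebra ℚ (-12) 1 →ₐ[ℚ] K :=
    lift ⟨(1 + a) / 2, by rw [hθ, Algebra.smul_def]; simp; ring⟩
  let g : QuadraticAlgebra ℤ (-12) 1 →ₐ[ℤ] 𝓞 K :=
    lift ⟨θ, by
      apply RingOfIntegers.ext
      simp only [Algebra.smul_def, map_add, map_mul, hθK, hθ]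
      simp [map_ofNat (algebraMap (𝓞 K) K) 12]
      ring⟩
  have hf : Function.Injective f := algHom_injective (eq_zero_of_norm_eq_zero (by norm_num)) f
  have hg : Function.Injective g := algHom_injective (eq_zero_of_norm_eq_zero (by norm_num)) g
  have hfsurj : Function.Surjective f :=
    (LinearMap.injective_iff_surjective_of_finrank_eq_finrank (f := f.toLinearMap)
      (by rw [hK, finrank_eq_two])).mp hf
  refine ⟨AlgEquiv.ofBijective g ⟨hg, fun x ↦ ?_⟩⟩
  obtain ⟨z, hz⟩ := hfsurj x
  have hzint : IsIntegral ℤ z := by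
    have : IsIntegral ℤ (f z) := hz ▸ x.isIntegral_coe
    exact (isIntegral_algHom_iff (f.restrictScalars ℤ) hf).mp this
  have hzstar : IsIntegral ℤ (star z) :=
    hzint.map (starRingEnd (QuadraticAlgebra ℚ (-12) 1)).toIntAlgHom
  have hinj := FaithfulSMul.algebraMap_injective ℚ (QuadraticAlgebra ℚ (-12) 1)
  obtain ⟨t, ht⟩ : ∃ t : ℤ, (t : ℚ) = 2 * z.re + z.im := by
    refine IsIntegrallyClosed.isIntegral_iff.mp ((isIntegral_algebraMap_iff hinj).mp ?_)
    convert hzint.add hzstar using 1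
    ext <;> simp
    ring
  obtain ⟨n, hn⟩ : ∃ n : ℤ, (n : ℚ) = norm z := by
    refine IsIntegrallyClosed.isIntegral_iff.mp ((isIntegral_algebraMap_iff hinj).mp ?_)
    rw [algebraMap_norm_eq_mul_star]
    exact hzint.mul hzstar
  rw [norm_def] at hn
  obtain ⟨k, l, hk, hl⟩ := Rat.isInt_of_trace_norm_isInt ht.symm (n := n) (by rw [hn]; ring)
  refine ⟨⟨k, l⟩, RingOfIntegers.ext ?_⟩
  rw [← hz]
  simp [f, g, lift, hk, hl, hθK, Algebra.smul_def]

theorem span_two_omega_ne_top :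
    Ideal.span {2, (ω : QuadraticAlgebra ℤ (-12) 1)} ≠ ⊤ := by
  rw [Ne, Ideal.eq_top_iff_one, Ideal.mem_span_pair]
  rintro ⟨u, v, h⟩
  have := congrArg re h
  simp at this
  omega

theorem not_isPrincipal_span_two_omega :
    ¬(Ideal.span {2, (ω : QuadraticAlgebra ℤ (-12) 1)}).IsPrincipal := by
  rintro ⟨z, hz⟩
  rw [Ideal.submodule_span_eq] at hz
  apply span_two_omega_ne_top
  have h2 : norm z ∣ 4 := by
    obtain ⟨w, hw⟩ := Ideal.mem_span_singleton'.mp (hz ▸ Ideal.subset_span (Set.mem_insert 2 _))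
    have := congrArg norm hw
    rw [map_mul, norm_def (2 : QuadraticAlgebra ℤ (-12) 1)] at this
    exact ⟨norm w, by rw [mul_comm, this]; simp⟩
  have hθ : norm z ∣ 18 := by
    have hmem : 2 + ω ∈ Ideal.span {2, (ω : QuadraticAlgebra ℤ (-12) 1)} :=
      Ideal.mem_span_pair.mpr ⟨1, 1, by ring⟩
    obtain ⟨w, hw⟩ := Ideal.mem_span_singleton'.mp (hz ▸ hmem)
    have := congrArg norm hw
    rw [map_mul, norm_def (2 + ω)] at this
    exact ⟨norm w, by rw [mul_comm, this]; simp⟩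
  have hdvd : norm z ∣ 2 := by simpa using (hθ.sub (h2.mul_left 4))
  have hval : (2 * z.re + z.im) ^ 2 + 47 * z.im ^ 2 = 4 * norm z := by rw [norm_def]; ring
  have hnonneg : 0 ≤ norm z := by nlinarith [sq_nonneg (2 * z.re + z.im), sq_nonneg z.im]
  have hle := Int.le_of_dvd two_pos hdvd
  have him : z.im = 0 := by
    by_contra him
    nlinarith [sq_nonneg (2 * z.re + z.im), Int.one_le_abs him, sq_abs z.im]
  rw [him] at hval
  have hone : norm z = 1 := by
    interval_cases hnorm : norm z
    · omega
    · rfl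
    · have : z.re ^ 2 = 2 := by linarith
      have h1 : z.re < 2 := by nlinarith
      have h3 : -2 < z.re := by nlinarith
      interval_cases z.re <;> omega
  rw [hz, Ideal.span_singleton_eq_top, isUnit_iff_norm_isUnit, hone]
  exact isUnit_one

end QuadraticAlgebra

theorem NumberField.minkowskiBound_lt_five {K : Type*} [Field K] [NumberField K]
    (hK : finrank ℚ K = 2) (hd : discr K = -47) :
    (4 / π) ^ InfinitePlace.nrComplexPlaces K *
      ((finrank ℚ K).factorial / (finrank ℚ K) ^ (finrank ℚ K) * √|(discr K : ℤ)|) < 5 := by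
  have hr : InfinitePlace.nrComplexPlaces K ≤ 1 := by
    have := InfinitePlace.card_add_two_mul_card_eq_rank K
    omega
  have hpow : (4 / π) ^ InfinitePlace.nrComplexPlaces K ≤ 4 / 3 := by
    have h1 : 1 ≤ 4 / π := (one_le_div Real.pi_pos).mpr Real.pi_le_four
    have h2 : 4 / π ≤ 4 / 3 := by gcongr; exact Real.pi_gt_three.le
    exact ((pow_le_pow_right₀ h1 hr).trans_eq (pow_one _)).trans h2
  have hsqrt : √47 < 7 := (Real.sqrt_lt' (by norm_num)).mpr (by norm_num)
  rw [hK, hd]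
  calc _ ≤ (4 / 3 : ℝ) * ((2 : ℕ).factorial / (2 : ℕ) ^ 2 * √|((-47 : ℤ) : ℝ)|) := by gcongr
    _ = 2 / 3 * √47 := by norm_num; ring
    _ < 5 := by linarith

theorem Ideal.IsPrime.two_mem_or_three_mem {R : Type*} [CommRing R] [IsDedekindDomain R]
    [Module.Free ℤ R] {I : Ideal R} (hI : I.IsPrime) (h0 : Ideal.absNorm I ≠ 0)
    (h : Ideal.absNorm I < 5) : (2 : R) ∈ I ∨ (3 : R) ∈ I := by
  have hmem := Ideal.absNorm_mem I
  have h1 : Ideal.absNorm I ≠ 1 := mt Ideal.absNorm_eq_one_iff.mp hI.ne_top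
  interval_cases Ideal.absNorm I
  · exact absurd rfl h0
  · exact absurd rfl h1
  · exact .inl (mod_cast hmem)
  · exact .inr (mod_cast hmem)
  · rw [show ((4 : ℕ) : R) = 2 * 2 by norm_num] at hmem
    exact .inl ((or_self_iff).mp (hI.mem_or_mem hmem))

theorem classGroup_Q_sqrt_neg47_cyclic_order_five
    (K : Type) [Field K] [NumberField K]
    (a : K) (ha : a ^ 2 = -47) (hK : Module.finrank ℚ K = 2) :
    Nonempty (ClassGroup (NumberField.RingOfIntegers K) ≃* Multiplicative (ZMod 5)) := by
  obtain ⟨e⟩ := QuadraticAlgebra.nonempty_algEquiv_ringOfIntegers a ha hK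
  set θ : 𝓞 K := e ω with hθdef
  have hθ : θ ^ 2 = θ - 12 := by
    rw [hθdef, ← map_pow, pow_two, QuadraticAlgebra.omega_mul_omega_eq_add]
    simp [map_ofNat e 12]
    ring
  have hgen (x : 𝓞 K) : ∃ k l : ℤ, x = k + l * θ := by
    obtain ⟨⟨k, l⟩, rfl⟩ := e.surjective x
    refine ⟨k, l, ?_⟩
    rw [QuadraticAlgebra.mk_eq_add_smul_omega, map_add, map_smul]
    simp [hθdef]
  have hd : discr K = -47 := by
    rw [← discr_eq_discr K ((QuadraticAlgebra.basis (-12 : ℤ) 1).map e.toLinearEquiv)]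
    trans Algebra.discr ℤ (QuadraticAlgebra.basis (-12 : ℤ) 1)
    · exact (Algebra.discr_eq_discr_of_algEquiv _ e).symm
    · rw [QuadraticAlgebra.discr_basis]; norm_num
  have hmem {J : Ideal (𝓞 K)} {x : 𝓞 K} (hx : x ∈ J) (hx0 : x ≠ 0) : J ∈ (Ideal (𝓞 K))⁰ :=
    mem_nonZeroDivisors_iff_ne_zero.mpr fun h ↦ hx0 (by simpa [h] using hx)
  have h2 (x : 𝓞 K) := hmem (Ideal.mem_span_pair (x := (2 : 𝓞 K)) (y := x).mpr ⟨1, 0, by ring⟩)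
    two_ne_zero
  have h3 (x : 𝓞 K) := hmem (Ideal.mem_span_pair (x := (3 : 𝓞 K)) (y := x).mpr ⟨1, 0, by ring⟩)
    (OfNat.ofNat_ne_zero 3)
  let c : ClassGroup (𝓞 K) := ClassGroup.mk0 ⟨_, h2 θ⟩
  have hc : c ≠ 1 := by
    rw [Ne, ClassGroup.mk0_eq_one_iff]
    intro hP
    apply QuadraticAlgebra.not_isPrincipal_span_two_omega
    have := hP.map_ringHom (e.symm : 𝓞 K →+* QuadraticAlgebra ℤ (-12) 1)
    rw [Ideal.map_span, Set.image_pair] at this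
    simpa [hθdef, map_ofNat e.symm 2] using this
  have hc5 : c ^ 5 = 1 := by
    rw [← map_pow, SubmonoidClass.mk_pow, ClassGroup.mk0_eq_one_iff, span_two_pow_five hθ]
    exact ⟨_, rfl⟩
  have hc2 : ClassGroup.mk0 ⟨_, h2 (θ - 1)⟩ = c⁻¹ := by
    rw [eq_inv_iff_mul_eq_one, mul_comm, ← map_mul, MulMemClass.mk_mul_mk,
      ClassGroup.mk0_eq_one_iff, span_two_mul_span_two hθ]
    exact ⟨_, rfl⟩
  have hc3 : ClassGroup.mk0 ⟨_, h3 θ⟩ = (c ^ 2)⁻¹ := by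
    rw [eq_inv_iff_mul_eq_one, mul_comm, ← map_pow, ← map_mul, SubmonoidClass.mk_pow,
      MulMemClass.mk_mul_mk, ClassGroup.mk0_eq_one_iff, span_two_sq_mul_span_three hθ]
    exact ⟨_, rfl⟩
  have hc3' : ClassGroup.mk0 ⟨_, h3 (θ - 1)⟩ = c ^ 2 := by
    rw [← inv_inv (c ^ 2), ← hc3, eq_inv_iff_mul_eq_one, mul_comm, ← map_mul,
      MulMemClass.mk_mul_mk, ClassGroup.mk0_eq_one_iff, span_three_mul_span_three hθ]
    exact ⟨_, rfl⟩
  have hcmem := Subgroup.mem_zpowers c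
  have htop : Subgroup.zpowers c = ⊤ := by
    refine classGroup_subgroup_eq_top _ fun ⟨I, hI0⟩ hI hle ↦ ?_
    simp only at hI hle
    have hlt : Ideal.absNorm I < 5 := by
      exact_mod_cast hle.trans_lt (minkowskiBound_lt_five hK hd)
    have hfac : (12 : 𝓞 K) ∈ I → θ ∈ I ∨ θ - 1 ∈ I := fun h12 ↦ hI.mem_or_mem <| by
      rw [show θ * (θ - 1) = -12 by linear_combination hθ]
      exact I.neg_mem h12
    rcases hI.two_mem_or_three_mem (Ideal.absNorm_ne_zero_of_nonZeroDivisors ⟨I, hI0⟩) hlt with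
      hn | hn
    · rcases hfac (by convert I.mul_mem_left 6 hn using 1; norm_num) with hr | hr
      · obtain rfl : I = Ideal.span {2, θ} := by
          simpa using Ideal.eq_span_pair_of_mem hgen hI.ne_top Nat.prime_two 0
            (by simpa using hn) (by simpa using hr)
        exact hcmem
      · obtain rfl : I = Ideal.span {2, θ - 1} := by
          simpa using Ideal.eq_span_pair_of_mem hgen hI.ne_top Nat.prime_two 1
            (by simpa using hn) (by simpa using hr)
        exact hc2 ▸ inv_mem hcmem
    · rcases hfac (by convert I.mul_mem_left 4 hn using 1; norm_num) with hr | hr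
      · obtain rfl : I = Ideal.span {3, θ} := by
          simpa using Ideal.eq_span_pair_of_mem hgen hI.ne_top Nat.prime_three 0
            (by simpa using hn) (by simpa using hr)
        exact hc3 ▸ inv_mem (pow_mem hcmem 2)
      · obtain rfl : I = Ideal.span {3, θ - 1} := by
          simpa using Ideal.eq_span_pair_of_mem hgen hI.ne_top Nat.prime_three 1
            (by simpa using hn) (by simpa using hr)
        exact hc3' ▸ pow_mem hcmem 2
  have : Fact (Nat.Prime 5) := ⟨Nat.prime_five⟩
  have hcard : Nat.card (ClassGroup (𝓞 K)) = 5 := by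
    rw [← orderOf_eq_prime hc5 hc, ← Nat.card_zpowers, htop, Subgroup.card_top]
  exact ⟨mulEquivOfPrimeCardEq (p := 5) hcard (by simp)⟩
end

section
/- No finite subgroup of GL₂(ℂ) has a subquotient isomorphic to PSL₂(𝔽₁₉₉): for every finite subgroup G of GL₂(ℂ), every subgroup H of G, and every normal subgroup N of H, the quotient group H/N is not isomorphic to PSL₂(𝔽₁₉₉). -/
/-- The centralizer of a nonscalar `2 × 2` matrix is commutative. -/
theorem Matrix.commute_of_commute_nonscalar {K : Type*} [Field K]
    {X A B : Matrix (Fin 2) (Fin 2) K} (hX : ∀ k : K, X ≠ Matrix.scalar (Fin 2) k)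
    (hA : Commute A X) (hB : Commute B X) : Commute A B := by
  have hX' : X 0 1 ≠ 0 ∨ X 1 0 ≠ 0 ∨ X 0 0 - X 1 1 ≠ 0 := by
    by_contra! h
    refine hX (X 0 0) ?_
    ext i j
    fin_cases i <;> fin_cases j <;> simp [h.1, h.2.1]
    exact (sub_eq_zero.mp h.2.2).symm
  have e (M N : Matrix (Fin 2) (Fin 2) K) (i j : Fin 2) :
      (M * N) i j = M i 0 * N 0 j + M i 1 * N 1 j := by
    simp [Matrix.mul_apply, Fin.sum_univ_two]
  have key (M N : Matrix (Fin 2) (Fin 2) K) : Commute M N ↔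
      (M 0 1 * N 1 0 = M 1 0 * N 0 1 ∧ (M 0 0 - M 1 1) * N 0 1 = M 0 1 * (N 0 0 - N 1 1) ∧
        (M 0 0 - M 1 1) * N 1 0 = M 1 0 * (N 0 0 - N 1 1)) := by
    constructor
    · intro h
      have h' (i j) := congrFun (congrFun h.eq i) j
      simp only [e] at h'
      refine ⟨?_, ?_, ?_⟩
      · linear_combination h' 0 0
      · linear_combination h' 0 1
      · linear_combination -h' 1 0
    · rintro ⟨h1, h2, h3⟩
      ext i j
      fin_cases i <;> fin_cases j <;> simp only [Fin.zero_eta, Fin.mk_one, e]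
      · linear_combination h1
      · linear_combination h2
      · linear_combination -h3
      · linear_combination -h1
  rw [key] at hA hB ⊢
  grind

theorem smul_one_add_pow_of_mul_self_eq_zero {K A : Type*} [Field K] [Ring A] [Algebra K A]
    {T : A} (hT : T * T = 0) (s : K) (m : ℕ) :
    (s • 1 + T) ^ (m + 1) = s ^ (m + 1) • (1 : A) + ((m + 1) * s ^ m) • T := by
  induction m with
  | zero => simp
  | succ m ih =>
    rw [pow_succ, ih]
    simp only [mul_add, add_mul, smul_mul_assoc, mul_smul_comm, hT, one_mul, mul_one]
    push_cast
    module

theorem eq_zero_of_mul_self_eq_zero_of_pow_eq_one {K A : Type*} [Field K] [CharZero K] [Ring A]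
    [Algebra K A] {T : A} (hT : T * T = 0) {s : K} {m : ℕ} (hm : m ≠ 0)
    (h : (s • 1 + T) ^ m = 1) : T = 0 := by
  obtain ⟨m, rfl⟩ := Nat.exists_eq_succ_of_ne_zero hm
  rw [Nat.succ_eq_add_one, smul_one_add_pow_of_mul_self_eq_zero hT] at h
  by_contra h0
  have h1 : (s ^ (m + 1) - 1) • T = 0 := by
    have := congrArg (· * T) h
    simp only [add_mul, smul_mul_assoc, one_mul, hT, smul_zero, add_zero] at this
    rw [sub_smul, this, one_smul, sub_self]
  have h2 : s ^ (m + 1) = 1 := sub_eq_zero.mp ((smul_eq_zero.mp h1).resolve_right h0)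
  rw [h2, one_smul, add_eq_left] at h
  have h3 := (smul_eq_zero.mp h).resolve_right h0
  have hs : s ≠ 0 := by rintro rfl; simp at h2
  exact mul_ne_zero (Nat.cast_add_one_ne_zero m) (pow_ne_zero m hs) h3

theorem Matrix.exists_eq_smul_of_commute_of_trace_eq_zero {K : Type*} [Field K] [CharZero K]
    {T S : Matrix (Fin 2) (Fin 2) K} (hT : T 1 1 = -T 0 0) (hS : S 1 1 = -S 0 0) (hT0 : T ≠ 0)
    (h : Commute T S) : ∃ k : K, S = k • T := by
  have h' (i j) := congrFun (congrFun h.eq i) j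
  simp only [Matrix.mul_apply, Fin.sum_univ_two] at h'
  have h2 : (2 : K) ≠ 0 := two_ne_zero
  have h00 := h' 0 0
  have h01 := h' 0 1
  have h10 := h' 1 0
  have e1 : T 0 0 * S 0 1 = T 0 1 * S 0 0 := by
    refine mul_left_cancel₀ h2 ?_
    rw [hT, hS] at h01
    linear_combination h01
  have e2 : T 0 0 * S 1 0 = T 1 0 * S 0 0 := by
    refine mul_left_cancel₀ h2 ?_
    rw [hT, hS] at h10
    linear_combination -h10
  have e3 : T 0 1 * S 1 0 = T 1 0 * S 0 1 := by linear_combination h00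
  have hne : T 0 0 ≠ 0 ∨ T 0 1 ≠ 0 ∨ T 1 0 ≠ 0 := by
    by_contra! h0
    refine hT0 ?_
    ext i j
    fin_cases i <;> fin_cases j <;> simp [h0.1, h0.2.1, h0.2.2, hT]
  rcases hne with h0 | h0 | h0
  on_goal 1 => refine ⟨S 0 0 / T 0 0, ?_⟩
  on_goal 2 => refine ⟨S 0 1 / T 0 1, ?_⟩
  on_goal 3 => refine ⟨S 1 0 / T 1 0, ?_⟩
  all_goals
    ext i j
    fin_cases i <;> fin_cases j <;> simp only [Fin.zero_eta, Fin.mk_one, Matrix.smul_apply,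
      smul_eq_mul, hT, hS] <;> field_simp <;> grind

/-- If `X` is a nonscalar `2 × 2` matrix of finite order that commutes with its conjugate by `N`,
then `N ^ 2` commutes with `X`. -/
theorem Matrix.commute_sq_of_conj_commute {K : Type*} [Field K] [CharZero K]
    {X Y N : Matrix (Fin 2) (Fin 2) K} (hX : ∀ k : K, X ≠ Matrix.scalar (Fin 2) k)
    (hN : IsUnit N) (hconj : N * X = Y * N) (hXY : Commute X Y) {m : ℕ} (hm : m ≠ 0)
    (hXm : X ^ m = 1) : Commute (N ^ 2) X := by
  obtain ⟨n, rfl⟩ := hN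
  have hY : Y = n.val * X * n⁻¹.val := by rw [hconj]; simp [mul_assoc]
  have htr : Y.trace = X.trace := by rw [hY, Matrix.trace_units_conj]
  have hdet : Y.det = X.det := by rw [hY, Matrix.det_units_conj]
  obtain ⟨s, hs⟩ : ∃ s : K, X.trace = 2 * s := ⟨X.trace / 2, by ring⟩
  obtain ⟨T, hT⟩ : ∃ T, X = (s • 1 : Matrix (Fin 2) (Fin 2) K) + T :=
    ⟨X - (s • 1 : Matrix (Fin 2) (Fin 2) K), by abel⟩
  obtain ⟨S, hS⟩ : ∃ S, Y = (s • 1 : Matrix (Fin 2) (Fin 2) K) + S :=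
    ⟨Y - (s • 1 : Matrix (Fin 2) (Fin 2) K), by abel⟩
  have hsc (M : Matrix (Fin 2) (Fin 2) K) : Commute ((s • 1 : Matrix (Fin 2) (Fin 2) K)) M :=
    (Commute.one_left M).smul_left s
  have hconjT : n.val * T = S * n.val := by
    rw [hT, hS, mul_add, add_mul, (hsc n.val).eq] at hconj
    exact add_left_cancel hconj
  have hTr : T 1 1 = -T 0 0 := by
    rw [hT] at hs
    simp [Matrix.trace_fin_two] at hs
    linear_combination hs
  have hSr : S 1 1 = -S 0 0 := by
    rw [← htr, hS] at hs
    simp [Matrix.trace_fin_two] at hs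
    linear_combination hs
  have hTS : Commute T S := by
    have h1 : Commute T Y := by
      have : T = X - (s • 1 : Matrix (Fin 2) (Fin 2) K) := by rw [hT]; abel
      rw [this]; exact hXY.sub_left (hsc Y)
    have : S = Y - (s • 1 : Matrix (Fin 2) (Fin 2) K) := by rw [hS]; abel
    rw [this]; exact h1.sub_right (hsc T).symm
  have hTd : T.det = S.det := by
    rw [Matrix.det_fin_two, Matrix.det_fin_two] at hdet ⊢
    rw [hT, hS] at hdet
    simp at hdet
    linear_combination -hdet + s * hSr - s * hTr
  have hT0 : T ≠ 0 := by
    rintro rfl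
    exact hX s (by rw [hT, add_zero, Matrix.scalar_apply, Matrix.smul_one_eq_diagonal])
  obtain ⟨k, hk⟩ := Matrix.exists_eq_smul_of_commute_of_trace_eq_zero hTr hSr hT0 hTS
  have hk2 : k ^ 2 = 1 := by
    have hTdet : T.det ≠ 0 := by
      intro h0
      refine hT0 (eq_zero_of_mul_self_eq_zero_of_pow_eq_one ?_ hm (hT ▸ hXm))
      rw [Matrix.det_fin_two, hTr] at h0
      ext i j
      fin_cases i <;> fin_cases j <;> simp [Matrix.mul_apply, Fin.sum_univ_two, hTr] <;> grind
    rw [hk, Matrix.det_smul, Fintype.card_fin] at hTd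
    exact mul_right_cancel₀ hTdet (by rw [one_mul, ← hTd])
  have hNT : Commute (n.val ^ 2) T := by
    calc n.val ^ 2 * T = n.val * (n.val * T) := by rw [sq, mul_assoc]
      _ = k ^ 2 • (T * n.val ^ 2) := by
        rw [hconjT, hk, smul_mul_assoc, mul_smul_comm, ← mul_assoc, hconjT, hk, smul_mul_assoc,
          smul_mul_assoc, smul_smul, sq, sq, mul_assoc]
      _ = T * n.val ^ 2 := by rw [hk2, one_smul]
  rw [hT]
  exact (hsc _).symm.add_right hNT

theorem commute_iff_map_GL {n K Γ : Type*} [Fintype n] [DecidableEq n] [CommRing K] [Group Γ]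
    {ρ : Γ →* GL n K} (hρ : Function.Injective ρ) (a b : Γ) :
    Commute a b ↔ Commute (ρ a).val (ρ b).val := by
  rw [commute_iff_eq, commute_iff_eq, ← hρ.eq_iff, map_mul, map_mul, Units.ext_iff,
    Units.val_mul, Units.val_mul]

/-- For odd `p`, a finite `p`-subgroup of `GL₂` is commutative. -/
theorem IsPGroup.commute_of_injective_to_GL2 {K P : Type*} [Field K] [Group P]
    [Finite P] {p : ℕ} [Fact p.Prime] (hp : p ≠ 2) (hP : IsPGroup p P)
    {ρ : P →* GL (Fin 2) K} (hρ : Function.Injective ρ) (x y : P) : Commute x y := by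
  by_contra hxy
  have hcen : ∀ z ∈ Subgroup.center P, ∃ k : K, (ρ z).val = Matrix.scalar (Fin 2) k := by
    intro z hz
    by_contra! h
    refine hxy ((commute_iff_map_GL hρ x y).2 (Matrix.commute_of_commute_nonscalar h ?_ ?_))
    · exact (commute_iff_map_GL hρ x z).1 (Subgroup.mem_center_iff.1 hz x)
    · exact (commute_iff_map_GL hρ y z).1 (Subgroup.mem_center_iff.1 hz y)
  have hne : Nontrivial (P ⧸ Subgroup.center P) := by
    rw [QuotientGroup.nontrivial_iff]
    intro h
    exact hxy (Subgroup.mem_center_iff.1 (h ▸ Subgroup.mem_top y) x)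
  have := (hP.to_quotient (Subgroup.center P)).center_nontrivial
  obtain ⟨⟨q, hq⟩, hq1⟩ := exists_ne (1 : Subgroup.center (P ⧸ Subgroup.center P))
  obtain ⟨w, rfl⟩ := QuotientGroup.mk_surjective q
  have hw : w ∉ Subgroup.center P := by
    intro h
    exact hq1 (Subtype.ext ((QuotientGroup.eq_one_iff w).2 h))
  refine hw (Subgroup.mem_center_iff.2 fun g => ?_)
  have hz : g * w * (w * g)⁻¹ ∈ Subgroup.center P := by
    rw [← QuotientGroup.eq_one_iff, QuotientGroup.mk_mul, QuotientGroup.mk_inv, mul_inv_eq_one]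
    exact Subgroup.mem_center_iff.1 hq g
  set z := g * w * (w * g)⁻¹ with hz_def
  obtain ⟨k, hk⟩ := hcen z hz
  have hdet : k ^ 2 = 1 := by
    have : (ρ z).val.det = 1 := by
      rw [← Matrix.GeneralLinearGroup.val_det_apply, hz_def]
      rw [map_mul, map_inv, map_mul, map_mul, map_mul, map_inv, map_mul, map_mul,
        mul_comm (Matrix.GeneralLinearGroup.det (ρ w)), mul_inv_cancel, Units.val_one]
    rw [hk] at this
    simpa [Matrix.det_fin_two, sq] using this
  have hz2 : z ^ 2 = 1 := by
    refine hρ (Units.ext ?_)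
    rw [map_pow, Units.val_pow_eq_pow_val, hk, ← map_pow, hdet]
    simp
  obtain ⟨n, hn⟩ := hP z
  have hcop : Nat.Coprime 2 (p ^ n) :=
    Nat.Coprime.pow_right n ((Nat.coprime_primes Nat.prime_two Fact.out).2 hp.symm)
  have hz1 : z = 1 := by
    rw [← pow_one z, ← hcop.gcd_eq_one, pow_gcd_eq_one]
    exact ⟨hz2, hn⟩
  exact mul_inv_eq_one.1 hz1

/-- If a finite subgroup of `GL₂` surjects onto `B` and `U` is a normal `p`-subgroup of `B` with `p`
odd, then squares in `B` centralize `U`. -/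
theorem commute_sq_of_normal_isPGroup_of_GL2 {K Γ B : Type*} [Field K] [CharZero K] [Group Γ]
    [Finite Γ] [Group B] {ρ : Γ →* GL (Fin 2) K} (hρ : Function.Injective ρ) {f : Γ →* B}
    (hf : Function.Surjective f) {p : ℕ} [Fact p.Prime] (hp : p ≠ 2) {U : Subgroup B} [U.Normal]
    (hU : IsPGroup p U) (b : B) {u : B} (hu : u ∈ U) : Commute (b ^ 2) u := by
  let M := U.comap f
  let P : Sylow p M := default
  let P' : Subgroup Γ := P.map M.subtype
  have hP' : IsPGroup p P' := P.2.map _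
  have hPU : P'.map f = U := by
    let g : M →* U := f.subgroupComap U
    have hg : Function.Surjective g := f.subgroupComap_surjective_of_surjective U hf
    have htop : (P.mapSurjective hg).1 = ⊤ := by
      refine ((P.mapSurjective hg).3 (hU.to_subgroup ⊤) le_top).symm
    have : P'.map f = (P.map g).map U.subtype := by
      rw [Subgroup.map_map, Subgroup.map_map]; rfl
    rw [this, ← Sylow.coe_mapSurjective hg, htop, ← MonoidHom.range_eq_map,
      Subgroup.range_subtype]
  have hcomm : ∀ x ∈ P', ∀ y ∈ P', Commute x y := fun x hx y hy =>
    congrArg Subtype.val (hP'.commute_of_injective_to_GL2 hp (ρ := ρ.comp P'.subtype)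
      (hρ.comp P'.subtype_injective) ⟨x, hx⟩ ⟨y, hy⟩).eq
  have hUcomm : ∀ x ∈ U, ∀ y ∈ U, Commute x y := by
    rw [← hPU]
    rintro _ ⟨x, hx, rfl⟩ _ ⟨y, hy, rfl⟩
    exact (hcomm x hx y hy).map f
  have hnorm : ∀ n ∈ Subgroup.normalizer (P' : Set Γ), ∀ x ∈ P', Commute (n ^ 2) x := by
    intro n hn x hx
    by_cases h : ∀ k : K, (ρ x).val ≠ Matrix.scalar (Fin 2) k
    · have hx' : n * x * n⁻¹ ∈ P' := (Subgroup.mem_normalizer_iff.1 hn x).1 hx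
      have hm : x ^ Nat.card Γ = 1 := pow_card_eq_one'
      have := Matrix.commute_sq_of_conj_commute h (Y := (ρ (n * x * n⁻¹)).val)
        (ρ n).isUnit (by simp [mul_assoc]) ((commute_iff_map_GL hρ _ _).1 (hcomm x hx _ hx'))
        Nat.card_pos.ne' (by rw [← Units.val_pow_eq_pow_val, ← map_pow, hm]; simp)
      rw [commute_iff_map_GL hρ]
      simpa using this
    · push Not at h
      obtain ⟨k, hk⟩ := h
      rw [commute_iff_map_GL hρ, hk]
      exact (Matrix.scalar_commute k (fun _ => Commute.all _ _) _).symm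
  have hfr : Subgroup.normalizer (P' : Set Γ) ⊔ M = ⊤ := Sylow.normalizer_sup_eq_top P
  obtain ⟨c, rfl⟩ := hf b
  obtain ⟨n, hn, m, hm, rfl⟩ := Subgroup.mem_sup_of_normal_right.1 (hfr.ge (Subgroup.mem_top c))
  have hm : f m ∈ U := hm
  have hn2 : ∀ v ∈ U, Commute (f n ^ 2) v := by
    rw [← hPU]
    rintro _ ⟨x, hx, rfl⟩
    rw [← map_pow]
    exact (hnorm n hn x hx).map f
  have hconj : (f n)⁻¹ * f m * f n ∈ U := by
    simpa using Subgroup.Normal.conj_mem ‹U.Normal› _ hm (f n)⁻¹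
  have : f (n * m) ^ 2 = f n ^ 2 * ((f n)⁻¹ * f m * f n) * f m := by
    simp [sq, mul_assoc]
  rw [this]
  exact ((hn2 u hu).mul_left (hUcomm _ hconj u hu)).mul_left (hUcomm _ hm u hu)

theorem commute_sq_of_conj_eq_pow_of_GL2 {K Γ Q : Type*} [Field K] [CharZero K] [Group Γ]
    [Finite Γ] [Group Q] {ρ : Γ →* GL (Fin 2) K} (hρ : Function.Injective ρ) {f : Γ →* Q}
    (hf : Function.Surjective f) {p : ℕ} [Fact p.Prime] (hp : p ≠ 2) {u t : Q} (hu : u ^ p = 1)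
    {k : ℕ} (ht : t * u * t⁻¹ = u ^ k) : Commute (t ^ 2) u := by
  have : Finite Q := Finite.of_surjective f hf
  let U := Subgroup.zpowers u
  let B := Subgroup.normalizer (U : Set Q)
  have hU : IsPGroup p U := by
    refine IsPGroup.of_card_dvd_pow (n := 1) ?_
    rw [Nat.card_zpowers, pow_one]
    exact orderOf_dvd_of_pow_eq_one hu
  have htB : t ∈ B := by
    refine Subgroup.mem_normalizer_fintype fun n hn => ?_
    obtain ⟨j, rfl⟩ := Subgroup.mem_zpowers_iff.1 hn
    rw [← conj_zpow, ht]
    exact zpow_mem (pow_mem (Subgroup.mem_zpowers u) k) j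
  have huB : u ∈ B := Subgroup.le_normalizer (Subgroup.mem_zpowers u)
  have := commute_sq_of_normal_isPGroup_of_GL2 (ρ := ρ.comp (B.comap f).subtype)
    (hρ.comp (B.comap f).subtype_injective) (f.subgroupComap_surjective_of_surjective B hf) hp
    (U := U.subgroupOf B) (hU.of_equiv (Subgroup.subgroupOfEquivOfLe Subgroup.le_normalizer).symm)
    ⟨t, htB⟩ (u := ⟨u, huB⟩) (Subgroup.mem_zpowers u)
  exact congrArg Subtype.val this.eq

theorem no_finite_subgroup_of_GL2C_has_PSL2_F199_subquotient
    (G : Subgroup (Matrix.GeneralLinearGroup (Fin 2) ℂ)) (hG : Finite G)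
    (H : Subgroup G) (N : Subgroup H) [N.Normal] :
    ¬ Nonempty ((H ⧸ N) ≃*
      (Matrix.SpecialLinearGroup (Fin 2) (ZMod 199) ⧸
        Subgroup.center (Matrix.SpecialLinearGroup (Fin 2) (ZMod 199)))) := by
  rintro ⟨e⟩
  let π := QuotientGroup.mk' (Subgroup.center (Matrix.SpecialLinearGroup (Fin 2) (ZMod 199)))
  let u : Matrix.SpecialLinearGroup (Fin 2) (ZMod 199) := ⟨!![1, 1; 0, 1], by decide⟩
  let t : Matrix.SpecialLinearGroup (Fin 2) (ZMod 199) := ⟨!![2, 0; 0, 100], by decide⟩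
  have hu : u ^ 199 = 1 := by
    decide +kernel
  have ht : t * u * t⁻¹ = u ^ 4 := by
    decide +kernel
  have : Fact (Nat.Prime 199) := ⟨by norm_num⟩
  have hcomm : Commute (π t ^ 2) (π u) :=
    commute_sq_of_conj_eq_pow_of_GL2 (ρ := G.subtype.comp H.subtype)
      (G.subtype_injective.comp H.subtype_injective) (f := e.toMonoidHom.comp (QuotientGroup.mk' N))
      (e.surjective.comp (QuotientGroup.mk'_surjective N)) (p := 199) (by norm_num)
      (by rw [← map_pow, hu, map_one]) (k := 4)
      (by rw [← map_mul, ← map_inv, ← map_mul, ht, map_pow])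
  have hmem : t ^ 2 * u * (u * t ^ 2)⁻¹ ∈
      Subgroup.center (Matrix.SpecialLinearGroup (Fin 2) (ZMod 199)) := by
    rw [← QuotientGroup.eq_one_iff]
    change π _ = 1
    rw [map_mul, map_inv, mul_inv_eq_one, map_mul, map_mul, map_pow]
    exact hcomm.eq
  have hne : u.transpose * (t ^ 2 * u * (u * t ^ 2)⁻¹) ≠
      (t ^ 2 * u * (u * t ^ 2)⁻¹) * u.transpose := by
    decide +kernel
  exact hne (Subgroup.mem_center_iff.1 hmem _)
end

section
/- Every injective group homomorphism from the symmetric group S₃ into PGL₂(ℂ) lifts to an injective group homomorphism from S₃ into GL₂(ℂ): if φ : S₃ → PGL₂(ℂ) is injective, then there is an injective homomorphism ψ : S₃ → GL₂(ℂ) such that the composite of ψ with the natural projection GL₂(ℂ) → PGL₂(ℂ) equals φ. -/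
/-- A homomorphism from `S₃` is given by images of the rotation and of a swap which satisfy the
relations of the dihedral presentation. -/
theorem exists_monoidHom_permFinThree_of_relations {G : Type*} [Group G] {a s : G}
    (ha : a ^ 3 = 1) (hs : s ^ 2 = 1) (hsa : s * a = a⁻¹ * s) :
    ∃ ψ : Equiv.Perm (Fin 3) →* G, ψ (finRotate 3) = a ∧ ψ (Equiv.swap 1 2) = s := by
  let e : Equiv.Perm (Fin 3) → ℕ := fun σ => if Equiv.Perm.sign σ = 1 then 0 else 1
  let f : Equiv.Perm (Fin 3) → G := fun σ => a ^ (σ 0).val * s ^ e σ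
  have hinv : a⁻¹ = a ^ 2 := by
    rw [inv_eq_iff_mul_eq_one, ← pow_succ', ha]
  have hsa2 : s * a ^ 2 = a * s := by
    rw [pow_two, ← mul_assoc, hsa, mul_assoc, hsa, ← mul_assoc, ← mul_inv_rev, ← pow_two,
      ← hinv, inv_inv]
  have hrot (τ : Equiv.Perm (Fin 3)) : f (finRotate 3 * τ) = a * f τ := by
    have he : e (finRotate 3 * τ) = e τ := by revert τ; decide
    have h0 : (finRotate 3 * τ) 0 = τ 0 + 1 := by revert τ; decide
    simp only [f, he, h0, ← mul_assoc]
    congr 1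
    generalize τ 0 = k
    fin_cases k
    · simp
    · simp [pow_two]
    · simp [← pow_succ', ha]
  have hswap (τ : Equiv.Perm (Fin 3)) : f (Equiv.swap 1 2 * τ) = s * f τ := by
    have he : e τ = 0 ∧ e (Equiv.swap 1 2 * τ) = 1 ∨ e τ = 1 ∧ e (Equiv.swap 1 2 * τ) = 0 := by
      revert τ; decide
    have h0 : (Equiv.swap 1 2 * τ : Equiv.Perm (Fin 3)) 0 = -τ 0 := by revert τ; decide
    have hk (k : Fin 3) : s * a ^ k.val = a ^ (-k).val * s := by
      fin_cases k
      · simp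
      · simpa [← hinv] using hsa
      · simpa [show (-2 : Fin 3) = 1 from rfl] using hsa2
    simp only [f, h0, ← mul_assoc, hk]
    rw [mul_assoc]
    congr 1
    rcases he with ⟨h, h'⟩ | ⟨h, h'⟩
    · simp [h, h']
    · simp [h, h', ← pow_two, hs]
  have hnormal (σ : Equiv.Perm (Fin 3)) :
      σ = finRotate 3 ^ (σ 0).val * Equiv.swap 1 2 ^ e σ := by
    revert σ; decide
  have hmul_rot (n : ℕ) (τ : Equiv.Perm (Fin 3)) : f (finRotate 3 ^ n * τ) = a ^ n * f τ := by
    induction n with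
    | zero => simp
    | succ n ih => rw [pow_succ', mul_assoc, hrot, ih, pow_succ', mul_assoc]
  have hmul_swap (n : ℕ) (τ : Equiv.Perm (Fin 3)) :
      f (Equiv.swap 1 2 ^ n * τ) = s ^ n * f τ := by
    induction n with
    | zero => simp
    | succ n ih => rw [pow_succ', mul_assoc, hswap, ih, pow_succ', mul_assoc]
  have hone : f 1 = 1 := by simp [f, e]
  refine ⟨MonoidHom.mk' f fun σ τ => ?_, ?_, ?_⟩
  · conv_lhs => rw [hnormal σ, mul_assoc, hmul_rot, hmul_swap, ← mul_assoc]
  · simpa [hone] using hrot 1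
  · simpa [hone] using hswap 1

/-- Two homomorphisms from `S₃` agree if they agree on the rotation and on a swap. -/
theorem monoidHom_permFinThree_ext {G : Type*} [Group G] {φ ψ : Equiv.Perm (Fin 3) →* G}
    (hrot : φ (finRotate 3) = ψ (finRotate 3))
    (hswap : φ (Equiv.swap 1 2) = ψ (Equiv.swap 1 2)) : φ = ψ := by
  ext σ
  have h : ∃ i j : Fin 3, σ = finRotate 3 ^ i.val * Equiv.swap 1 2 ^ j.val := by
    revert σ; decide
  obtain ⟨i, j, rfl⟩ := h
  simp [hrot, hswap]

/-- If the central elements have central `n`-th roots, then an element whose `n`-th power is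
trivial modulo the center lifts to an element whose `n`-th power is trivial. -/
theorem exists_lift_pow_eq_one {G : Type*} [Group G] {n : ℕ}
    (hroot : ∀ z ∈ Subgroup.center G, ∃ w ∈ Subgroup.center G, w ^ n = z)
    {x : G ⧸ Subgroup.center G} (hx : x ^ n = 1) :
    ∃ g : G, (g : G ⧸ Subgroup.center G) = x ∧ g ^ n = 1 := by
  obtain ⟨g, rfl⟩ := QuotientGroup.mk_surjective x
  rw [← QuotientGroup.mk_pow, QuotientGroup.eq_one_iff] at hx
  obtain ⟨w, hw, hwg⟩ := hroot _ hx
  refine ⟨w⁻¹ * g, ?_, ?_⟩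
  · rw [QuotientGroup.mk_mul, (QuotientGroup.eq_one_iff _).2 (inv_mem hw), one_mul]
  · have hcomm : Commute w⁻¹ g := (Subgroup.mem_center_iff.1 (inv_mem hw) g).symm
    rw [hcomm.mul_pow, inv_pow, hwg, inv_mul_cancel]

/-- A homomorphism from `S₃` to `G` modulo its center lifts to `G` if the central elements have
central square roots and cube roots. -/
theorem exists_lift_permFinThree {G : Type*} [Group G]
    (hroot₂ : ∀ z ∈ Subgroup.center G, ∃ w ∈ Subgroup.center G, w ^ 2 = z)
    (hroot₃ : ∀ z ∈ Subgroup.center G, ∃ w ∈ Subgroup.center G, w ^ 3 = z)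
    (φ : Equiv.Perm (Fin 3) →* G ⧸ Subgroup.center G) :
    ∃ ψ : Equiv.Perm (Fin 3) →* G, (QuotientGroup.mk' (Subgroup.center G)).comp ψ = φ := by
  obtain ⟨s, hsφ, hs⟩ := exists_lift_pow_eq_one hroot₂ (x := φ (Equiv.swap 1 2))
    (by rw [← map_pow, show (Equiv.swap 1 2 : Equiv.Perm (Fin 3)) ^ 2 = 1 by decide, map_one])
  obtain ⟨a, haφ, ha⟩ := exists_lift_pow_eq_one hroot₃ (x := φ (finRotate 3))
    (by rw [← map_pow, show finRotate 3 ^ 3 = 1 by decide, map_one])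
  obtain ⟨μ, hμ⟩ : ∃ μ, μ = s * a * s⁻¹ * a := ⟨_, rfl⟩
  have hμ_mem : μ ∈ Subgroup.center G := by
    rw [← QuotientGroup.eq_one_iff, hμ]
    simp only [QuotientGroup.mk_mul, QuotientGroup.mk_inv, hsφ, haφ]
    rw [← map_inv, ← map_mul, ← map_mul, ← map_mul,
      show Equiv.swap 1 2 * finRotate 3 * (Equiv.swap 1 2)⁻¹ * finRotate 3 = 1 by decide, map_one]
  have hcomm (g : G) : Commute μ g := (Subgroup.mem_center_iff.1 hμ_mem g).symm
  have hconj : s * a * s⁻¹ = μ * a⁻¹ := by rw [hμ, mul_inv_cancel_right]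
  have hμ3 : μ ^ 3 = 1 := by
    have h := congrArg (· ^ 3) hconj
    simpa [conj_pow, ha, (hcomm a⁻¹).mul_pow, eq_comm] using h
  have hsμa : s * (μ * a) = (μ * a)⁻¹ * s := by
    have hμinv : μ * μ = μ⁻¹ := by
      rw [eq_inv_iff_mul_eq_one, ← hμ3, pow_succ, pow_two]
    rw [← mul_assoc, ← (hcomm s).eq, mul_assoc, mul_inv_eq_iff_eq_mul.1 hconj, mul_inv_rev,
      ← ((hcomm a⁻¹).inv_left).eq, ← hμinv]
    simp only [mul_assoc]
  obtain ⟨ψ, hψa, hψs⟩ := exists_monoidHom_permFinThree_of_relations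
    (by rw [(hcomm a).mul_pow, hμ3, ha, one_mul]) hs hsμa
  refine ⟨ψ, monoidHom_permFinThree_ext ?_ ?_⟩
  · simp [hψa, (QuotientGroup.eq_one_iff μ).2 hμ_mem, haφ]
  · simp [hψs, hsφ]

/-- The center of the general linear group over an algebraically closed field is divisible. -/
theorem exists_mem_center_pow_eq {ι K : Type*} [Fintype ι] [DecidableEq ι] [Field K]
    [IsAlgClosed K] {n : ℕ} (hn : 0 < n) (z : Matrix.GeneralLinearGroup ι K)
    (hz : z ∈ Subgroup.center (Matrix.GeneralLinearGroup ι K)) :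
    ∃ w ∈ Subgroup.center (Matrix.GeneralLinearGroup ι K), w ^ n = z := by
  rw [Matrix.GeneralLinearGroup.center_eq_range_scalar] at hz ⊢
  obtain ⟨u, rfl⟩ := hz
  obtain ⟨v, hv⟩ := IsAlgClosed.exists_pow_nat_eq (u : K) hn
  have hv0 : v ≠ 0 := by
    rintro rfl
    exact u.ne_zero (by rw [← hv, zero_pow hn.ne'])
  exact ⟨_, ⟨Units.mk0 v hv0, rfl⟩, by rw [← map_pow]; congr 1; ext; simpa using hv⟩


theorem injective_S3_into_PGL2C_lifts_to_GL2C
    (φ : Equiv.Perm (Fin 3) →*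
      (Matrix.GeneralLinearGroup (Fin 2) ℂ ⧸
        Subgroup.center (Matrix.GeneralLinearGroup (Fin 2) ℂ)))
    (hφ : Function.Injective φ) :
    ∃ ψ : Equiv.Perm (Fin 3) →* Matrix.GeneralLinearGroup (Fin 2) ℂ,
      Function.Injective ψ ∧
      (QuotientGroup.mk' (Subgroup.center (Matrix.GeneralLinearGroup (Fin 2) ℂ))).comp ψ = φ := by
  obtain ⟨ψ, hψ⟩ := exists_lift_permFinThree (exists_mem_center_pow_eq two_pos)
    (exists_mem_center_pow_eq three_pos) φ
  refine ⟨ψ, ?_, hψ⟩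
  rw [← hψ] at hφ
  exact Function.Injective.of_comp hφ
end
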